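/- Let T be a residually finite periodic semigroup. Then T is monogenic subsemigroup separability preserving if and only if T is a union of groups, i.e. every element of T belongs to a subgroup of T. -/

import Mathlib

/-- `s` can be separated from `Y` in `S`: there is a homomorphism to a finite
semigroup mapping `s` outside the image of `Y`. -/
def Separates {S : Type*} [Semigroup S] (s : S) (Y : Set S) : Prop :=
  ∃ (P : Type) (_ : Semigroup P) (_ : Finite P) (φ : S →ₙ* P), φ s ∉ φ '' Y

/-- Complete separability. -/
def IsCS (S : Type*) [Semigroup S] : Prop :=
  ∀ (s : S) (Y : Set S), s ∉ Y → Separates s Y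

/-- Strong subsemigroup separability. -/
def IsSSS (S : Type*) [Semigroup S] : Prop :=
  ∀ (s : S) (Y : Subsemigroup S), s ∉ Y → Separates s (Y : Set S)

/-- Weak subsemigroup separability. -/
def IsWSS (S : Type*) [Semigroup S] : Prop :=
  ∀ (s : S) (X : Finset S), s ∉ Subsemigroup.closure (X : Set S) →
    Separates s (Subsemigroup.closure (X : Set S) : Set S)

/-- Monogenic subsemigroup separability. -/
def IsMSS (S : Type*) [Semigroup S] : Prop :=
  ∀ (s x : S), s ∉ Subsemigroup.closure {x} →
    Separates s (Subsemigroup.closure {x} : Set S)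

/-- Residual finiteness. -/
def ResiduallyFinite (S : Type*) [Semigroup S] : Prop :=
  ∀ s t : S, s ≠ t → ∃ (P : Type) (_ : Semigroup P) (_ : Finite P) (φ : S →ₙ* P), φ s ≠ φ t

/-- `p` belongs to a subgroup of `P`: some subsemigroup of `P` containing `p`
is a group (it has a two-sided identity and two-sided inverses). -/
def MemSubgroup {P : Type*} [Semigroup P] (p : P) : Prop :=
  ∃ H : Subsemigroup P, p ∈ H ∧ ∃ e ∈ H,
    (∀ h ∈ H, e * h = h ∧ h * e = h) ∧ ∀ h ∈ H, ∃ h' ∈ H, h * h' = e ∧ h' * h = e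
/-- `T` preserves monogenic subsemigroup separability in direct products. -/
def MSSPreserving (T : Type*) [Semigroup T] : Prop :=
  ∀ (S : Type*) [Semigroup S], IsMSS S → IsMSS (S × T)

/-- `succPow x n` is the power `x ^ (n + 1)` in a semigroup. -/
def succPow {S : Type*} [Semigroup S] (x : S) : ℕ → S
  | 0 => x
  | n + 1 => succPow x n * x

section succPow

variable {S : Type*} [Semigroup S] {x : S}

theorem succPow_mul_succPow (x : S) (a b : ℕ) :
    succPow x a * succPow x b = succPow x (a + b + 1) := by
  induction b with
  | zero => rfl
  | succ b ih => rw [succPow, ← mul_assoc, ih]; rfl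

theorem succPow_succPow (x : S) (a b : ℕ) :
    succPow (succPow x a) b = succPow x (a * b + a + b) := by
  induction b with
  | zero => simp [succPow]
  | succ b ih =>
    rw [succPow, ih, succPow_mul_succPow]
    congr 1
    ring

theorem map_succPow {S' : Type*} [Semigroup S'] (φ : S →ₙ* S') (x : S) (n : ℕ) :
    φ (succPow x n) = succPow (φ x) n := by
  induction n with
  | zero => rfl
  | succ n ih => rw [succPow, map_mul, ih]; rfl

theorem succPow_mem {H : Subsemigroup S} (hx : x ∈ H) (n : ℕ) : succPow x n ∈ H := by
  induction n with
  | zero => exact hx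
  | succ n ih => exact H.mul_mem ih hx

theorem mem_closure_singleton_iff_succPow {s : S} :
    s ∈ Subsemigroup.closure {x} ↔ ∃ n, succPow x n = s := by
  constructor
  · intro h
    induction h using Subsemigroup.closure_induction with
    | mem y hy => exact ⟨0, (Set.mem_singleton_iff.1 hy).symm⟩
    | mul y z _ _ hy hz =>
      obtain ⟨a, rfl⟩ := hy
      obtain ⟨b, rfl⟩ := hz
      exact ⟨a + b + 1, (succPow_mul_succPow x a b).symm⟩
  · rintro ⟨n, rfl⟩
    exact succPow_mem (Subsemigroup.subset_closure (Set.mem_singleton _)) n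

theorem succPow_add_eq {a b : ℕ} (h : succPow x a = succPow x b) (c : ℕ) :
    succPow x (a + c) = succPow x (b + c) := by
  induction c with
  | zero => exact h
  | succ c ih => rw [← add_assoc, ← add_assoc, succPow, ih]; rfl

theorem succPow_add_mul_period {a c d : ℕ} (h : succPow x a = succPow x (a + d)) (hc : a ≤ c)
    (m : ℕ) : succPow x (c + m * d) = succPow x c := by
  induction m with
  | zero => simp
  | succ m ih =>
    rw [← ih]
    have := succPow_add_eq h (c + m * d - a)
    rw [show a + (c + m * d - a) = c + m * d by omega,
      show a + d + (c + m * d - a) = c + (m + 1) * d by rw [add_mul]; omega] at this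
    exact this.symm

theorem closure_singleton_eq_range_succPow (x : S) :
    (Subsemigroup.closure {x} : Set S) = Set.range (succPow x) :=
  Set.ext fun _ => SetLike.mem_coe.trans mem_closure_singleton_iff_succPow

theorem exists_succPow_eq_of_finite (hx : (Subsemigroup.closure {x} : Set S).Finite) :
    ∃ a d, succPow x a = succPow x (a + (d + 1)) := by
  rw [closure_singleton_eq_range_succPow] at hx
  have : Finite (Set.range (succPow x)) := hx
  obtain ⟨a, b, hab, h⟩ := Finite.exists_ne_map_eq_of_infinite (Set.rangeFactorization (succPow x))
  replace h : succPow x a = succPow x b := congrArg Subtype.val h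
  rcases lt_or_gt_of_ne hab with hlt | hlt
  · exact ⟨a, b - a - 1, by rw [h]; congr 1; omega⟩
  · exact ⟨b, a - b - 1, by rw [← h]; congr 1; omega⟩

theorem exists_succPow_idempotent_of_finite (hx : (Subsemigroup.closure {x} : Set S).Finite) :
    ∃ n, succPow x n * succPow x n = succPow x n := by
  obtain ⟨a, d, h⟩ := exists_succPow_eq_of_finite hx
  have hpos : a + 1 ≤ (a + 1) * (d + 1) := Nat.le_mul_of_pos_right _ (Nat.succ_pos d)
  refine ⟨(a + 1) * (d + 1) - 1, ?_⟩
  rw [succPow_mul_succPow, add_assoc, show (a + 1) * (d + 1) - 1 + 1 = (a + 1) * (d + 1) by omega]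
  exact succPow_add_mul_period h (by omega) _

theorem memSubgroup_of_succPow_succ_eq {n : ℕ} (h : succPow x (n + 1) = x) : MemSubgroup x := by
  have hper (c m : ℕ) : succPow x (c + m * (n + 1)) = succPow x c :=
    succPow_add_mul_period (a := 0) (by rw [zero_add, h]; rfl) (Nat.zero_le c) m
  refine ⟨Subsemigroup.closure {x}, Subsemigroup.subset_closure (Set.mem_singleton _), succPow x n,
    mem_closure_singleton_iff_succPow.2 ⟨n, rfl⟩, fun y hy => ?_, fun y hy => ?_⟩
  · obtain ⟨k, rfl⟩ := mem_closure_singleton_iff_succPow.1 hy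
    have := hper k 1
    rw [succPow_mul_succPow, succPow_mul_succPow]
    exact ⟨by rw [← this]; congr 1; ring, by rw [← this]; congr 1; ring⟩
  · obtain ⟨k, rfl⟩ := mem_closure_singleton_iff_succPow.1 hy
    have := hper n (2 * k + 1)
    refine ⟨succPow x (2 * k * n + 2 * n + k), mem_closure_singleton_iff_succPow.2 ⟨_, rfl⟩, ?_, ?_⟩ <;>
      rw [succPow_mul_succPow, ← this] <;> congr 1 <;> ring

theorem MemSubgroup.exists_succPow_succ_eq (h : MemSubgroup x)
    (hx : (Subsemigroup.closure {x} : Set S).Finite) : ∃ n, succPow x (n + 1) = x := by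
  obtain ⟨H, hxH, e, -, he, hinv⟩ := h
  obtain ⟨a, d, hd⟩ := exists_succPow_eq_of_finite hx
  obtain ⟨y, -, -, hy⟩ := hinv _ (succPow_mem hxH a)
  refine ⟨d, ?_⟩
  have hde : succPow x d = e := by
    rw [← (he _ (succPow_mem hxH d)).1, ← hy, mul_assoc, succPow_mul_succPow, add_assoc, ← hd]
  rw [succPow, hde, (he x hxH).1]

end succPow

section Separates

variable {S : Type*} [Semigroup S] {s : S}

theorem Separates.mono {Y Z : Set S} (h : Separates s Z) (hYZ : Y ⊆ Z) : Separates s Y := by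
  obtain ⟨P, iP, fP, φ, hφ⟩ := h
  exact ⟨P, iP, fP, φ, fun hs => hφ (Set.image_mono hYZ hs)⟩

theorem Separates.comap {S' : Type*} [Semigroup S'] (f : S →ₙ* S') {Y : Set S'}
    (h : Separates (f s) Y) : Separates s (f ⁻¹' Y) := by
  obtain ⟨P, iP, fP, φ, hφ⟩ := h
  exact ⟨P, iP, fP, φ.comp f, fun ⟨y, hy, he⟩ => hφ ⟨f y, hy, he⟩⟩

theorem separates_empty : Separates s ∅ :=
  ⟨Unit, inferInstance, inferInstance, ⟨fun _ => (), fun _ _ => rfl⟩, by simp⟩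

theorem Separates.union {Y Z : Set S} (hY : Separates s Y) (hZ : Separates s Z) :
    Separates s (Y ∪ Z) := by
  obtain ⟨P, iP, fP, φ, hφ⟩ := hY
  obtain ⟨Q, iQ, fQ, ψ, hψ⟩ := hZ
  refine ⟨P × Q, inferInstance, inferInstance, φ.prod ψ, ?_⟩
  rintro ⟨y, hy | hy, he⟩
  · exact hφ ⟨y, hy, congrArg Prod.fst he⟩
  · exact hψ ⟨y, hy, congrArg Prod.snd he⟩

theorem separates_biUnion {ι : Type*} {F : Set ι} (hF : F.Finite) {Y : ι → Set S}
    (h : ∀ i ∈ F, Separates s (Y i)) : Separates s (⋃ i ∈ F, Y i) := by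
  induction F, hF using Set.Finite.induction_on with
  | empty => simpa using separates_empty
  | insert _ _ ih =>
    rw [Set.biUnion_insert]
    exact (h _ (Set.mem_insert _ _)).union (ih fun i hi => h i (Set.mem_insert_of_mem _ hi))

theorem ResiduallyFinite.separates_of_finite (hS : ResiduallyFinite S) {Y : Set S}
    (hY : Y.Finite) (hs : s ∉ Y) : Separates s Y := by
  have := separates_biUnion (s := s) hY (Y := fun y => {y}) fun y hy => by
    obtain ⟨P, iP, fP, φ, hφ⟩ := hS s y fun h => hs (h ▸ hy)
    exact ⟨P, iP, fP, φ, by simpa using hφ⟩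
  simpa using this

theorem ResiduallyFinite.prod {T : Type*} [Semigroup T] (hS : ResiduallyFinite S)
    (hT : ResiduallyFinite T) : ResiduallyFinite (S × T) := by
  rintro ⟨s, t⟩ ⟨s', t'⟩ hne
  by_cases h : s = s'
  · obtain ⟨P, iP, fP, φ, hφ⟩ := hT t t' fun h' => hne (by rw [h, h'])
    exact ⟨P, iP, fP, φ.comp (MulHom.snd S T), hφ⟩
  · obtain ⟨P, iP, fP, φ, hφ⟩ := hS s s' h
    exact ⟨P, iP, fP, φ.comp (MulHom.fst S T), hφ⟩

theorem IsMSS.of_injective {S' : Type*} [Semigroup S'] (hS' : IsMSS S') (f : S →ₙ* S')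
    (hf : Function.Injective f) : IsMSS S := by
  intro s x hs
  refine ((hS' (f s) (f x) fun h => hs ?_).comap f).mono fun y hy => ?_
  · obtain ⟨n, hn⟩ := mem_closure_singleton_iff_succPow.1 h
    exact mem_closure_singleton_iff_succPow.2 ⟨n, hf (by rw [map_succPow, hn])⟩
  · obtain ⟨n, rfl⟩ := mem_closure_singleton_iff_succPow.1 hy
    exact mem_closure_singleton_iff_succPow.2 ⟨n, (map_succPow f x n).symm⟩

theorem IsMSS.residuallyFinite (hS : IsMSS S) : ResiduallyFinite S := by
  intro s t hst
  by_cases hs : s ∈ Subsemigroup.closure {t}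
  swap
  · obtain ⟨P, iP, fP, φ, hφ⟩ := hS s t hs
    exact ⟨P, iP, fP, φ, fun h => hφ ⟨t, Subsemigroup.subset_closure (Set.mem_singleton _), h.symm⟩⟩
  by_cases ht : t ∈ Subsemigroup.closure {s}
  swap
  · obtain ⟨P, iP, fP, φ, hφ⟩ := hS t s ht
    exact ⟨P, iP, fP, φ, fun h => hφ ⟨s, Subsemigroup.subset_closure (Set.mem_singleton _), h⟩⟩
  obtain ⟨m, rfl⟩ := mem_closure_singleton_iff_succPow.1 hs
  obtain ⟨n, hn⟩ := mem_closure_singleton_iff_succPow.1 ht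
  rw [succPow_succPow] at hn
  obtain _ | m := m
  · exact absurd rfl hst
  -- `succPow t N` is the identity of the cyclic group generated by `t`.
  obtain ⟨N, hN⟩ : ∃ N, (m + 1) * n + (m + 1) + n = N + 1 := ⟨(m + 1) * n + m + n, by ring⟩
  rw [hN] at hn
  have hper (c : ℕ) : succPow t (c + (N + 1)) = succPow t c := by
    have := succPow_add_eq (a := N + 1) (b := 0) hn c
    rwa [zero_add, add_comm] at this
  have hidem (k : ℕ) : succPow (succPow t N) k = succPow t N := by
    induction k with
    | zero => rfl
    | succ k ih => rw [succPow, ih, succPow_mul_succPow, add_assoc, hper]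
  have hmem : succPow t m ∉ Subsemigroup.closure {succPow t N} := by
    intro h
    obtain ⟨k, hk⟩ := mem_closure_singleton_iff_succPow.1 h
    rw [hidem] at hk
    exact hst (by rw [succPow, ← hk]; exact hn)
  obtain ⟨P, iP, fP, φ, hφ⟩ := hS _ _ hmem
  refine ⟨P, iP, fP, φ, fun h => hφ ⟨succPow t N, Subsemigroup.subset_closure (Set.mem_singleton _), ?_⟩⟩
  have hmul : φ (succPow t (m + 1) * succPow t (N + N)) = φ (t * succPow t (N + N)) := by
    rw [map_mul, map_mul, h]
  rw [succPow_mul_succPow, show m + 1 + (N + N) + 1 = m + (N + 1) + (N + 1) by ring, hper, hper,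
    show t * succPow t (N + N) = succPow t 0 * succPow t (N + N) from rfl, succPow_mul_succPow,
    show 0 + (N + N) + 1 = N + (N + 1) by ring, hper] at hmul
  exact hmul.symm

theorem IsMSS.separates_succPow_residue (hS : IsMSS S) {x : S}
    (hx : Function.Injective (succPow x)) (i : ℕ) {k r : ℕ} (hr : r ≠ 0) (hrk : r < k) :
    Separates (succPow x i) {y | ∃ n, n ≡ i + r [MOD k] ∧ succPow x n = y} := by
  obtain ⟨K, rfl⟩ : ∃ K, k = K + 1 := ⟨k - 1, by omega⟩
  obtain ⟨c, hc⟩ : ∃ c, c + 1 = r + (K + 1) * (i + 1) :=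
    ⟨r + (K + 1) * (i + 1) - 1, by have := Nat.mul_pos K.succ_pos i.succ_pos; omega⟩
  have hic : i + r ≤ c := by nlinarith
  have hmem : succPow x c ∉ Subsemigroup.closure {succPow x K} := by
    intro h
    obtain ⟨m, hm⟩ := mem_closure_singleton_iff_succPow.1 h
    rw [succPow_succPow] at hm
    have hdvd : K + 1 ∣ r + (K + 1) * (i + 1) := by
      rw [← hc, ← hx hm]
      exact ⟨m + 1, by ring⟩
    exact hr (Nat.eq_zero_of_dvd_of_lt ((Nat.dvd_add_left (dvd_mul_right _ _)).1 hdvd) hrk)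
  obtain ⟨P, iP, fP, φ, hφ⟩ := hS _ _ hmem
  refine ⟨P, iP, fP, φ, ?_⟩
  rintro ⟨_, ⟨n, hn, rfl⟩, he⟩
  suffices h : ∃ b, K + 1 ∣ b + 1 ∧ φ (succPow x b) = φ (succPow x c) by
    obtain ⟨b, ⟨q, hq⟩, hb⟩ := h
    refine hφ ⟨succPow x b, mem_closure_singleton_iff_succPow.2 ?_, hb⟩
    obtain _ | q := q
    · omega
    · exact ⟨q, by rw [succPow_succPow]; congr 1; linarith⟩
  rw [map_succPow, map_succPow] at he
  simp only [map_succPow]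
  have hn' : (K + 1 : ℤ) ∣ i + r - n := by
    have := (Nat.modEq_iff_dvd.1 hn)
    push_cast at this
    exact this
  have hcz : (c + 1 : ℤ) = r + (K + 1) * (i + 1) := by exact_mod_cast hc
  obtain ⟨z, hz⟩ := hn'
  rcases le_total i n with hin | hin
  · obtain ⟨d, rfl⟩ := Nat.exists_eq_add_of_le hin
    refine ⟨c + K * d, ?_, succPow_add_mul_period he.symm (by omega) _⟩
    zify
    push_cast at hz
    exact ⟨i + 1 + d + z, by linear_combination hcz + hz⟩
  · obtain ⟨d, rfl⟩ := Nat.exists_eq_add_of_le hin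
    refine ⟨c + 1 * d, ?_, succPow_add_mul_period he (by omega) _⟩
    zify
    push_cast at hz hcz
    exact ⟨n + d + 1 + z, by linear_combination hcz + hz⟩

end Separates

theorem MSSPreserving.of_memSubgroup {T : Type*} [Semigroup T] (hrf : ResiduallyFinite T)
    (hper : ∀ t : T, (Subsemigroup.closure {t} : Set T).Finite)
    (hgrp : ∀ t : T, MemSubgroup t) : MSSPreserving T := by
  rintro S _ hS ⟨s, t⟩ ⟨x, y⟩ hmem
  have hfst (n : ℕ) : (succPow (x, y) n).1 = succPow x n := map_succPow (MulHom.fst S T) (x, y) n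
  have hsnd (n : ℕ) : (succPow (x, y) n).2 = succPow y n := map_succPow (MulHom.snd S T) (x, y) n
  have hle : (Subsemigroup.closure {(x, y)} : Set (S × T)) ⊆
      (Subsemigroup.closure {x} : Set S) ×ˢ (Subsemigroup.closure {y} : Set T) := by
    intro z hz
    obtain ⟨n, rfl⟩ := mem_closure_singleton_iff_succPow.1 hz
    exact ⟨mem_closure_singleton_iff_succPow.2 ⟨n, (hfst n).symm⟩,
      mem_closure_singleton_iff_succPow.2 ⟨n, (hsnd n).symm⟩⟩
  by_cases hs : s ∈ Subsemigroup.closure {x}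
  swap
  · exact (Separates.comap (s := (s, t)) (MulHom.fst S T) (hS s x hs)).mono fun z hz => (hle hz).1
  by_cases ht : t ∈ Subsemigroup.closure {y}
  swap
  · exact (Separates.comap (s := (s, t)) (MulHom.snd S T)
      (hrf.separates_of_finite (hper y) ht)).mono fun z hz => (hle hz).2
  by_cases hfin : (Subsemigroup.closure {x} : Set S).Finite
  · exact (hS.residuallyFinite.prod hrf).separates_of_finite ((hfin.prod (hper y)).subset hle) hmem
  have hinj : Function.Injective (succPow x) := by
    by_contra hinj
    refine hfin ?_
    obtain ⟨a, b, hab, hlt⟩ : ∃ a b, succPow x a = succPow x b ∧ a < b := by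
      simp only [Function.Injective, not_forall] at hinj
      obtain ⟨a, b, h, hne⟩ := hinj
      rcases lt_or_gt_of_ne hne with hlt | hlt
      exacts [⟨a, b, h, hlt⟩, ⟨b, a, h.symm, hlt⟩]
    rw [closure_singleton_eq_range_succPow]
    refine ((Set.finite_lt_nat b).image (succPow x)).subset ?_
    rintro _ ⟨n, rfl⟩
    induction n using Nat.strong_induction_on with
    | _ n ih =>
      by_cases hn : n < b
      · exact ⟨n, hn, rfl⟩
      · have := succPow_add_eq hab (n - b)
        rw [show b + (n - b) = n by omega] at this
        rw [← this]
        exact ih _ (by omega)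
  obtain ⟨i, rfl⟩ := mem_closure_singleton_iff_succPow.1 hs
  obtain ⟨k, hk⟩ := (hgrp y).exists_succPow_succ_eq (hper y)
  have hmod {a b : ℕ} (h : a ≡ b [MOD k + 1]) : succPow y a = succPow y b := by
    have hred (c : ℕ) : succPow y c = succPow y (c % (k + 1)) := by
      conv_lhs => rw [← Nat.mod_add_div' c (k + 1)]
      exact succPow_add_mul_period (a := 0) (by rw [zero_add, hk]; rfl) (Nat.zero_le _) _
    rw [hred a, hred b, h]
  have hti : t ≠ succPow y i := by
    rintro rfl
    exact hmem (mem_closure_singleton_iff_succPow.2 ⟨i, Prod.ext (hfst i) (hsnd i)⟩)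
  have hres := separates_biUnion (Set.finite_Ioo 0 (k + 1)) fun r hr =>
    hS.separates_succPow_residue hinj i (k := k + 1) hr.1.ne' hr.2
  have hone := hrf.separates_of_finite (Set.finite_singleton (succPow y i)) (s := t) hti
  refine ((Separates.comap (s := (succPow x i, t)) (MulHom.fst S T) hres).union
    (Separates.comap (s := (succPow x i, t)) (MulHom.snd S T) hone)).mono fun z hz => ?_
  obtain ⟨n, rfl⟩ := mem_closure_singleton_iff_succPow.1 hz
  by_cases hn : n ≡ i [MOD k + 1]
  · exact Or.inr ((hsnd n).trans (hmod hn))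
  · refine Or.inl (Set.mem_biUnion (x := (n + k * i) % (k + 1)) ⟨?_, Nat.mod_lt _ k.succ_pos⟩
      ⟨n, ?_, (hfst n).symm⟩)
    · refine Nat.pos_of_ne_zero fun h0 => hn ?_
      have h1 : n + k * i ≡ 0 [MOD k + 1] := h0
      have h2 := h1.add_right i
      rw [zero_add, show n + k * i + i = n + (k + 1) * i by ring] at h2
      exact ((Nat.ModEq.refl n).add (Nat.modEq_zero_iff_dvd.2 (dvd_mul_right _ _))).symm.trans h2
    · have h1 : i + (n + k * i) % (k + 1) ≡ i + (n + k * i) [MOD k + 1] :=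
        (Nat.mod_modEq _ _).add_left i
      refine Nat.ModEq.symm (h1.trans ?_)
      rw [show i + (n + k * i) = n + (k + 1) * i by ring]
      exact (Nat.ModEq.refl n).add (Nat.modEq_zero_iff_dvd.2 (dvd_mul_right _ _))

/-- The Rees matrix semigroup over an additive commutative monoid with the square sandwich
matrix `p`. -/
@[ext]
structure ReesMatrix {I G : Type*} (p : I → I → G) where
  row : I
  val : G
  col : I

namespace ReesMatrix

theorem finite {I G : Type*} {p : I → I → G} [Finite I] [Finite G] : Finite (ReesMatrix p) :=
  Finite.of_injective (fun a => (a.row, a.val, a.col)) fun a b h => by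
    simp only [Prod.mk.injEq] at h
    exact ReesMatrix.ext h.1 h.2.1 h.2.2

variable {I G J H : Type*} [AddCommMonoid G] [AddCommMonoid H] {p : I → I → G} {q : J → J → H}

instance : Semigroup (ReesMatrix p) where
  mul a b := ⟨a.row, a.val + p a.col b.row + b.val, b.col⟩
  mul_assoc a b c := ReesMatrix.ext rfl
    (show a.val + p a.col b.row + b.val + p b.col c.row + c.val
      = a.val + p a.col b.row + (b.val + p b.col c.row + c.val) by simp only [add_assoc]) rfl

theorem mk_mul_mk (i j k l : I) (a b : G) :
    (⟨i, a, j⟩ * ⟨k, b, l⟩ : ReesMatrix p) = ⟨i, a + p j k + b, l⟩ := rfl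

theorem succPow_mk (i j : I) (a : G) (n : ℕ) :
    succPow (⟨i, a, j⟩ : ReesMatrix p) n = ⟨i, a + n • (p j i + a), j⟩ := by
  induction n with
  | zero => simp [succPow]
  | succ n ih => rw [succPow, ih, mk_mul_mk, succ_nsmul, add_assoc, add_assoc]

/-- The homomorphism induced by compatible maps of index sets and of coefficients. -/
def map (f : I → J) (g : G →+ H) (h : ∀ i j, q (f i) (f j) = g (p i j)) :
    ReesMatrix p →ₙ* ReesMatrix q where
  toFun a := ⟨f a.row, g a.val, f a.col⟩
  map_mul' a b := ReesMatrix.ext rfl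
    (show g (a.val + p a.col b.row + b.val) = g a.val + q (f a.col) (f b.row) + g b.val by
      rw [h, map_add, map_add]) rfl

end ReesMatrix

/-- A sandwich matrix over `ℕ` with diagonal entries `1` whose other entries tend to `1` in the
profinite topology. -/
def factorialSandwich (i j : ℕ) : ℕ :=
  if i = j then 1 else 1 + 2 * (i + j).factorial

theorem factorialSandwich_pos (i j : ℕ) : 0 < factorialSandwich i j := by
  unfold factorialSandwich
  split <;> omega

theorem factorialSandwich_min_modEq {K : ℕ} (hK : 0 < K) (i j : ℕ) :
    factorialSandwich (min i K) (min j K) ≡ factorialSandwich i j [MOD K] := by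
  have hone {a b : ℕ} (h : K ≤ a + b) : factorialSandwich a b ≡ 1 [MOD K] := by
    unfold factorialSandwich
    split
    · rfl
    · exact (Nat.ModEq.refl 1).add (Nat.modEq_zero_iff_dvd.2
        ((Nat.dvd_factorial hK h).mul_left 2))
  by_cases h : i < K ∧ j < K
  · rw [min_eq_left h.1.le, min_eq_left h.2.le]
  · exact (hone (by omega)).trans (hone (by omega)).symm

theorem isMSS_reesMatrix_factorialSandwich : IsMSS (ReesMatrix factorialSandwich) := by
  rintro ⟨i, n, l⟩ ⟨j, m, k⟩ hmem
  obtain ⟨K, hK, hdvd, hi, hl, hj, hk⟩ : ∃ K, 0 < K ∧ factorialSandwich k j + m ∣ K ∧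
      i < K ∧ l < K ∧ j < K ∧ k < K := by
    have hpos := factorialSandwich_pos k j
    have := Nat.le_mul_of_pos_left (i + l + j + k + 1) (show 0 < factorialSandwich k j + m by omega)
    exact ⟨(factorialSandwich k j + m) * (i + l + j + k + 1), by omega, dvd_mul_right _ _,
      by omega, by omega, by omega, by omega⟩
  have : NeZero K := ⟨hK.ne'⟩
  let q : Fin (K + 1) → Fin (K + 1) → ZMod K := fun a b => (factorialSandwich a b : ℕ)
  let φ : ReesMatrix factorialSandwich →ₙ* ReesMatrix q :=
    ReesMatrix.map (fun a => ⟨min a K, by omega⟩) (Nat.castAddMonoidHom (ZMod K)) fun a b =>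
      (ZMod.natCast_eq_natCast_iff _ _ _).2 (factorialSandwich_min_modEq hK a b)
  refine ⟨ReesMatrix q, inferInstance, ReesMatrix.finite, φ, ?_⟩
  rintro ⟨y, hy, he⟩
  obtain ⟨c, rfl⟩ := mem_closure_singleton_iff_succPow.1 hy
  rw [ReesMatrix.succPow_mk] at he
  obtain ⟨h1, h2, h3⟩ := ReesMatrix.mk.injEq .. ▸ he
  have hji : min j K = min i K := congrArg Fin.val h1
  have hkl : min k K = min l K := congrArg Fin.val h3
  obtain rfl : j = i := by omega
  obtain rfl : k = l := by omega
  have hmod : m + c • (factorialSandwich k j + m) ≡ n [MOD factorialSandwich k j + m] :=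
    ((ZMod.natCast_eq_natCast_iff _ _ _).1 h2).of_dvd hdvd
  have hzero : factorialSandwich k j + n ≡ 0 [MOD factorialSandwich k j + m] := by
    refine (hmod.symm.add_left _).trans (Nat.modEq_zero_iff_dvd.2 ⟨c + 1, ?_⟩)
    rw [smul_eq_mul]
    ring
  obtain ⟨d, hd⟩ := Nat.modEq_zero_iff_dvd.1 hzero
  have hpos := factorialSandwich_pos k j
  obtain _ | d := d
  · omega
  refine hmem (mem_closure_singleton_iff_succPow.2 ⟨d, ?_⟩)
  rw [ReesMatrix.succPow_mk, smul_eq_mul]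
  congr 1
  rw [mul_add, mul_comm] at hd
  linarith

theorem MSSPreserving.memSubgroup.{u, v} {T : Type u} [Semigroup T] (h : MSSPreserving.{u, v} T) {t : T}
    (ht : (Subsemigroup.closure {t} : Set T).Finite) : MemSubgroup t := by
  by_contra hgrp
  obtain ⟨N, hN⟩ := exists_succPow_idempotent_of_finite ht
  set e := succPow t N with he
  have hidem (k : ℕ) : succPow e k = e := by
    induction k with
    | zero => rfl
    | succ k ih => rw [succPow, ih, hN]
  let S := ULift.{v} (ReesMatrix factorialSandwich)
  have hS : IsMSS S := isMSS_reesMatrix_factorialSandwich.of_injective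
    (MulEquiv.ulift : S ≃* _).toMulHom MulEquiv.ulift.injective
  let x : S := ⟨⟨0, 1, 0⟩⟩
  have hx (n : ℕ) : succPow x n = ⟨⟨0, 1 + n * 2, 0⟩⟩ :=
    (map_succPow (MulEquiv.ulift : S ≃* _).symm.toMulHom (⟨0, 1, 0⟩ : ReesMatrix _) n).symm.trans
      (by rw [ReesMatrix.succPow_mk]; rfl)
  have hfst (n : ℕ) : (succPow (x, t) n).1 = succPow x n := map_succPow (MulHom.fst S T) (x, t) n
  have hsnd (n : ℕ) : (succPow (x, t) n).2 = succPow t n := map_succPow (MulHom.snd S T) (x, t) n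
  have hmem : (x, e * t) ∉ Subsemigroup.closure {(x, t)} := by
    intro hmem
    obtain ⟨n, hn⟩ := mem_closure_singleton_iff_succPow.1 hmem
    have h1 := (hfst n).symm.trans (congrArg Prod.fst hn)
    have h2 := (hsnd n).symm.trans (congrArg Prod.snd hn)
    rw [hx] at h1
    have h3 : 1 + n * 2 = 1 := congrArg (fun z : S => z.down.val) h1
    obtain rfl : n = 0 := by omega
    exact hgrp (memSubgroup_of_succPow_succ_eq (n := N) h2.symm)
  obtain ⟨P, iP, fP, ψ, hψ⟩ := h S hS _ _ hmem
  obtain ⟨a, b, hab, hψab⟩ := Finite.exists_ne_map_eq_of_infinite fun a : ℕ =>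
    ψ ((⟨⟨0, 0, a + N + 1⟩⟩ : S), e)
  obtain ⟨D, hD⟩ : N + 1 ∣ (b + N + 1 + (a + N + 1)).factorial :=
    Nat.dvd_factorial N.succ_pos (by omega)
  obtain _ | D := D
  · exact absurd hD (Nat.factorial_ne_zero _)
  refine hψ ⟨succPow (x, t) ((N + 1) * (D + 1)), mem_closure_singleton_iff_succPow.2 ⟨_, rfl⟩, ?_⟩
  have hleft : (x, e * t) = ((⟨⟨0, 0, a + N + 1⟩⟩ : S), e) * ((⟨⟨a + N + 1, 0, 0⟩⟩ : S), e * t) := by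
    refine Prod.ext (ULift.ext _ _ (ReesMatrix.ext rfl ?_ rfl)) ?_
    · change 1 = 0 + factorialSandwich (a + N + 1) (a + N + 1) + 0
      simp [factorialSandwich]
    · change e * t = e * (e * t)
      rw [← mul_assoc, hN]
  have hright : succPow (x, t) ((N + 1) * (D + 1)) =
      ((⟨⟨0, 0, b + N + 1⟩⟩ : S), e) * ((⟨⟨a + N + 1, 0, 0⟩⟩ : S), e * t) := by
    refine Prod.ext ?_ ?_
    · rw [hfst, hx]
      refine ULift.ext _ _ (ReesMatrix.ext rfl ?_ rfl)
      change 1 + (N + 1) * (D + 1) * 2 = 0 + factorialSandwich (b + N + 1) (a + N + 1) + 0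
      rw [factorialSandwich, if_neg (by omega), hD]
      ring
    · rw [hsnd]
      change _ = e * (e * t)
      rw [← mul_assoc, hN, show (N + 1) * (D + 1) = N * D + N + D + 1 by ring, succPow,
        ← succPow_succPow, ← he, hidem]
  rw [hleft, hright, map_mul, map_mul]
  exact congrArg (· * _) hψab.symm

/-- A residually finite periodic semigroup is monogenic-subsemigroup-separability
preserving iff it is a union of groups. -/
theorem stmt_18 (T : Type*) [Semigroup T] (hrf : ResiduallyFinite T)
    (hper : ∀ t : T, (Subsemigroup.closure {t} : Set T).Finite) :
    MSSPreserving T ↔ ∀ t : T, MemSubgroup t := by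
  exact ⟨fun h t => h.memSubgroup (hper t), MSSPreserving.of_memSubgroup hrf hper⟩
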